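/- arXiv:1011.5862 — 2 statements merged into one kernel-verified Lean document; each statement's English description precedes it below -/
import Mathlib

section
/- Let G = ⟨a_1,…,a_k | R⟩ be a C'(λ)-presentation with λ ≤ 1/100 and suppose every r ∈ R has |r| ≥ 2/λ + 1. Suppose moreover that whenever a power a_s^p (1 ≤ s ≤ k) occurs as a subword of some r ∈ R, then |p| < λ|r|. Then for all i ≠ j and all nonzero integers m, n, the element a_i^m is not conjugate to a_j^n in G. -/
/-- The formal inverse of a word: reverse the word and invert each letter. -/
def wordInv {α : Type} (l : List (α × Bool)) : List (α × Bool) :=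
  (l.map fun p => (p.1, !p.2)).reverse

/-- `u` is a (contiguous) subword of `w`. -/
def Subword {α : Type} (u w : List (α × Bool)) : Prop :=
  ∃ s t : List (α × Bool), w = s ++ u ++ t

/-- `g` is cyclically reduced: in its reduced word the first letter is not
the inverse of the last letter. -/
def CyclicallyReduced {α : Type} [DecidableEq α] (g : FreeGroup α) : Prop :=
  ∀ x y : α × Bool, g.toWord.head? = some x → g.toWord.getLast? = some y →
    x ≠ (y.1, !y.2)

/-- `R` is a symmetrized set of cyclically reduced words: it is closed under
inversion and under all cyclic permutations. -/
def Symmetrized {α : Type} [DecidableEq α] (R : Set (FreeGroup α)) : Prop :=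
  (∀ r ∈ R, CyclicallyReduced r) ∧
  (∀ r ∈ R, ∀ n : ℕ, FreeGroup.mk (r.toWord.rotate n) ∈ R) ∧
  (∀ r ∈ R, r⁻¹ ∈ R)

/-- `v` is a piece with respect to `R`: an initial segment of two distinct
elements of `R`. -/
def IsPiece {α : Type} [DecidableEq α] (R : Set (FreeGroup α)) (v : List (α × Bool)) : Prop :=
  ∃ r₁ ∈ R, ∃ r₂ ∈ R, r₁ ≠ r₂ ∧ v <+: r₁.toWord ∧ v <+: r₂.toWord

/-- `R` is a symmetrized `C'(λ)` small cancellation set: whenever a piece `v`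
with respect to `R` is a subword of some `r ∈ R`, then `|v| < λ|r|`. -/
def CPrime {α : Type} [DecidableEq α] (lam : ℝ) (R : Set (FreeGroup α)) : Prop :=
  Symmetrized R ∧
    ∀ v, IsPiece R v → ∀ r ∈ R, Subword v r.toWord →
      (v.length : ℝ) < lam * (r.toWord.length : ℝ)

namespace SCG

open FreeGroup

variable {α : Type}

/-- the inverse letter -/
def li (x : α × Bool) : α × Bool := (x.1, !x.2)

theorem li_li (x : α × Bool) : li (li x) = x := by simp [li]

theorem li_ne (x : α × Bool) : li x ≠ x := by
  intro h
  have := congrArg Prod.snd h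
  simp [li] at this

theorem invRev_single (x : α × Bool) : invRev [x] = [li x] := rfl

theorem invRev_cons' (x : α × Bool) (w : List (α × Bool)) :
    invRev (x :: w) = invRev w ++ [li x] := by simp [invRev, li]

theorem invRev_concat (x : α × Bool) (w : List (α × Bool)) :
    invRev (w ++ [x]) = li x :: invRev w := by simp [invRev, li]

theorem red_pair {s t : List (α × Bool)} {x y : α × Bool} (h : IsReduced (s ++ x :: y :: t)) :
    y ≠ li x := by
  have h2 : IsReduced [x, y] := h.infix ⟨s, t, by simp⟩
  rw [isReduced_cons_cons] at h2
  rintro rfl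
  have := h2.1 rfl
  simp [li] at this

theorem red_tail {x : α × Bool} {t : List (α × Bool)} (h : IsReduced (x :: t)) : IsReduced t :=
  h.infix ⟨[x], [], by simp⟩

theorem red_left {s t : List (α × Bool)} (h : IsReduced (s ++ t)) : IsReduced s :=
  h.infix ⟨[], t, by simp⟩

theorem red_right {s t : List (α × Bool)} (h : IsReduced (s ++ t)) : IsReduced t :=
  h.infix ⟨s, [], by simp⟩

/-- small cancellation set of words -/
structure SC (S : Set (List (α × Bool))) : Prop where
  rot : ∀ u v, u ++ v ∈ S → v ++ u ∈ S
  inv : ∀ r ∈ S, invRev r ∈ S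
  red : ∀ r ∈ S, IsReduced r
  len : ∀ r ∈ S, 201 ≤ r.length
  piece : ∀ u v v', u ++ v ∈ S → u ++ v' ∈ S → (u ++ v).length ≤ 100 * u.length → v = v'

section paths

variable {V : Type}

/-- `w` labels a path from `a` to `b` -/
def rd (E : V → α × Bool → V → Prop) : List (α × Bool) → V → V → Prop
  | [], a, b => a = b
  | x :: w, a, b => ∃ c, E a x c ∧ rd E w c b

variable {E : V → α × Bool → V → Prop}

theorem rd_append {u v : List (α × Bool)} {a b : V} :
    rd E (u ++ v) a b ↔ ∃ c, rd E u a c ∧ rd E v c b := by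
  induction u generalizing a with
  | nil => simp [rd]
  | cons x u ih =>
    simp only [List.cons_append, rd, ih]
    constructor
    · rintro ⟨c, h, d, h1, h2⟩; exact ⟨d, ⟨c, h, h1⟩, h2⟩
    · rintro ⟨d, ⟨c, h, h1⟩, h2⟩; exact ⟨c, h, d, h1, h2⟩

theorem rd_single {x : α × Bool} {a b : V} : rd E [x] a b ↔ E a x b := by
  simp [rd]

/-- folded symmetric labelled graph -/
structure Fold (E : V → α × Bool → V → Prop) : Prop where
  symm : ∀ a x b, E a x b → E b (li x) a
  det : ∀ a x b c, E a x b → E a x c → b = c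

theorem Fold.rd_det (h : Fold E) {u : List (α × Bool)} {a b c : V} (h1 : rd E u a b)
    (h2 : rd E u a c) : b = c := by
  induction u generalizing a with
  | nil => exact h1.symm.trans h2
  | cons x u ih =>
    obtain ⟨d, hd, h1⟩ := h1
    obtain ⟨d', hd', h2⟩ := h2
    cases h.det _ _ _ _ hd hd'
    exact ih h1 h2

theorem Fold.rd_inv (h : Fold E) {u : List (α × Bool)} {a b : V} (h1 : rd E u a b) :
    rd E (invRev u) b a := by
  induction u generalizing a with
  | nil => exact h1.symm
  | cons x u ih =>
    obtain ⟨d, hd, h1⟩ := h1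
    rw [invRev_cons', rd_append]
    exact ⟨d, ih h1, rd_single.2 (h.symm _ _ _ hd)⟩

theorem Fold.rd_back (h : Fold E) {u : List (α × Bool)} {a b c : V} (h1 : rd E u a c)
    (h2 : rd E u b c) : a = b :=
  h.rd_det (h.rd_inv h1) (h.rd_inv h2)

theorem Fold.clos_rot (h : Fold E) {u v : List (α × Bool)} {a b : V} (h1 : rd E u a b)
    (h2 : rd E (v ++ u) b b) : rd E (u ++ v) a a := by
  obtain ⟨c, hv, hu⟩ := rd_append.1 h2
  cases h.rd_back h1 hu
  exact rd_append.2 ⟨b, h1, hv⟩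

theorem Fold.clos_rot' (h : Fold E) {u v : List (α × Bool)} {a b : V} (h1 : rd E u a b)
    (h2 : rd E (u ++ v) a a) : rd E (v ++ u) b b := by
  obtain ⟨c, hv, hu⟩ := rd_append.1 h2
  cases h.rd_det h1 hv
  exact rd_append.2 ⟨a, hu, h1⟩

theorem Fold.rd_red (h : Fold E) {u v : List (α × Bool)} {a b : V} (hr : Red u v)
    (h1 : rd E u a b) : rd E v a b := by
  induction hr with
  | refl => exact h1
  | tail _ hs ih =>
    cases hs with
    | @not L1 L2 x c =>
      obtain ⟨d, hd, e, he, f, hf, h3⟩ := rd_append.1 ih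
      have h4 := h.symm _ _ _ he
      cases h.det _ _ _ _ h4 hf
      exact rd_append.2 ⟨d, hd, h3⟩

/-- good graphs -/
structure Good (S : Set (List (α × Bool))) (E : V → α × Bool → V → Prop) : Prop extends Fold E where
  close : ∀ u t a b, u ++ t ∈ S → rd E u a b → 20 * (u ++ t).length ≤ 100 * u.length →
    rd E (u ++ t) a a

/-- pending relators -/
@[ext] structure Pend (S : Set (List (α × Bool))) (E : V → α × Bool → V → Prop) where
  p : V
  q : V
  c : List (α × Bool)
  k : List (α × Bool)
  mem : c ++ k ∈ S
  path : rd E k q p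
  big : 15 * (c ++ k).length ≤ 100 * k.length
  small : 100 * k.length < 20 * (c ++ k).length
  hp : ∀ x t, c = x :: t → ∀ z, ¬ E p x z
  hq : ∀ x t, c = t ++ [x] → ∀ z, ¬ E q (li x) z

variable {S : Set (List (α × Bool))}

/-- the mirror pending relator -/
def Pend.star (hS : SC S) (hE : Fold E) (A : Pend S E) : Pend S E where
  p := A.q
  q := A.p
  c := invRev A.c
  k := invRev A.k
  mem := by
    have := hS.inv _ (hS.rot _ _ A.mem)
    simpa using this
  path := hE.rd_inv A.path
  big := by have := A.big; simpa using this
  small := by have := A.small; simpa using this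
  hp := by
    intro x t h z
    have h2 := congrArg invRev h
    rw [invRev_invRev, invRev_cons'] at h2
    have := A.hq _ _ h2 z
    rwa [li_li] at this
  hq := by
    intro x t h z
    have h2 := congrArg invRev h
    rw [invRev_invRev, invRev_concat] at h2
    exact A.hp _ _ h2 z

theorem Pend.star_star (hS : SC S) (hE : Fold E) (A : Pend S E) :
    (A.star hS hE).star hS hE = A := by
  ext1 <;> simp [Pend.star]

theorem Pend.star_ne (hS : SC S) (hE : Fold E) (A : Pend S E) : A.star hS hE ≠ A := by
  classical
  intro h
  have h1 : invRev A.c = A.c := congrArg Pend.c h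
  have h2 : (FreeGroup.mk A.c)⁻¹ = FreeGroup.mk A.c := by rw [inv_mk, h1]
  have h3 : (FreeGroup.mk A.c) ^ 2 = 1 := by
    rw [pow_two]; nth_rewrite 1 [← h2]; exact inv_mul_cancel _
  have h4 : FreeGroup.mk A.c = 1 := by
    rcases pow_eq_one_iff.1 h3 with h | h
    · exact h
    · omega
  have h5 : IsReduced A.c := red_left (hS.red _ A.mem)
  have h6 : A.c = [] := by
    have : (FreeGroup.mk A.c).toWord = [] := by rw [h4]; simp
    rwa [toWord_mk, h5.reduce_eq] at this
  have := A.small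
  rw [h6] at this
  simp at this
  omega

theorem exists_hh (hS : SC S) (hE : Fold E) : ∃ hh : Pend S E → ℕ, 
    (∀ A, hh A + hh (A.star hS hE) + 1 = A.c.length) ∧ ∀ A, A.c.length ≤ 2 * hh A + 2 := by
  classical
  refine ⟨fun A => if WellOrderingRel A (A.star hS hE) then A.c.length / 2 else (A.c.length - 1) / 2,
    ?_, ?_⟩
  · intro A
    have hl : (A.star hS hE).c.length = A.c.length := by simp [Pend.star]
    have hpos : 0 < A.c.length := by
      have := A.small
      simp at this
      omega
    simp only [hl, Pend.star_star]
    rcases trichotomous_of WellOrderingRel A (A.star hS hE) with h | h | h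
    · have h' : ¬ WellOrderingRel (A.star hS hE) A := fun h2 => asymm_of WellOrderingRel h h2
      simp only [h, h', if_true, if_false]; omega
    · exact absurd h.symm (A.star_ne hS hE)
    · have h' : ¬ WellOrderingRel A (A.star hS hE) := fun h2 => asymm_of WellOrderingRel h h2
      simp only [h, h', if_true, if_false]; omega
  · intro A
    dsimp only
    split <;> omega

theorem Pend.eq_of (hS : SC S) (hE : Fold E) (A B : Pend S E) (hp : A.p = B.p)
    {v s s' : List (α × Bool)} (hA : A.c = v ++ s) (hB : B.c = v ++ s')
    (hv : (A.c ++ A.k).length ≤ 100 * v.length) : A = B := by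
  have key : A.c ++ A.k = B.c ++ B.k := by
    have h1 := A.mem
    have h2 := B.mem
    rw [hA, List.append_assoc] at h1
    rw [hB, List.append_assoc] at h2
    rw [hA, List.append_assoc] at hv
    have := hS.piece _ _ _ h1 h2 hv
    rw [hA, hB, List.append_assoc, List.append_assoc, this]
  have aux : ∀ A B : Pend S E, A.p = B.p → A.c ++ A.k = B.c ++ B.k →
      ∀ as, B.c = A.c ++ as → A.k = as ++ B.k → as = [] := by
    intro A B hp _ as h1 h2
    rcases List.eq_nil_or_concat as with h | ⟨as', y, rfl⟩
    · exact h
    · exfalso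
      have h3 := A.path
      rw [List.concat_eq_append] at h1 h2
      rw [h2, List.append_assoc, rd_append] at h3
      obtain ⟨z, _, h3⟩ := h3
      obtain ⟨z', h4, h5⟩ := h3
      have h6 := B.path
      rw [← hp] at h6
      cases hE.rd_back h5 h6
      refine B.hq y (A.c ++ as') (by simp [h1]) z (hE.symm _ _ _ h4)
  have hck : A.c = B.c ∧ A.k = B.k := by
    rcases List.append_eq_append_iff.1 key with ⟨as, h1, h2⟩ | ⟨as, h1, h2⟩
    · cases aux A B hp key as h1 h2
      simp at h1 h2
      exact ⟨h1.symm, h2⟩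
    · cases aux B A hp.symm key.symm as h1 h2
      simp at h1 h2
      exact ⟨h1, h2.symm⟩
  have hq : A.q = B.q := by
    have h1 := A.path
    have h2 := B.path
    rw [hck.2, hp] at h1
    exact hE.rd_back h1 h2
  ext1
  exacts [hp, hq, hck.1, hck.2]

end paths

section step

variable {V : Type} {E : V → α × Bool → V → Prop} {S : Set (List (α × Bool))}

/-- context of the extension step -/
structure Ctx (S : Set (List (α × Bool))) (E : V → α × Bool → V → Prop) (hh : Pend S E → ℕ) :
    Prop where
  hS : SC S
  hG : Good S E
  sum : ∀ A, hh A + hh (A.star hS hG.toFold) + 1 = A.c.length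
  half : ∀ A : Pend S E, A.c.length ≤ 2 * hh A + 2

/-- hair words at `p` -/
def HW (hh : Pend S E → ℕ) (p : V) (h : List (α × Bool)) : Prop :=
  (∃ x, h = [x] ∧ ∀ z, ¬ E p x z) ∨
    ∃ A : Pend S E, A.p = p ∧ h ≠ [] ∧ (∃ t, A.c = h ++ t) ∧ h.length ≤ hh A

/-- edges of the extended graph -/
inductive EE (hh : Pend S E → ℕ) (a : V × List (α × Bool)) (x : α × Bool)
    (b : V × List (α × Bool)) : Prop
  | old (p q : V) (ha : a = (p, [])) (hb : b = (q, [])) (h : E p x q)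
  | up (p : V) (h : List (α × Bool)) (ha : a = (p, h)) (hb : b = (p, h ++ [x]))
      (hw : HW hh p (h ++ [x]))
  | down (p : V) (h : List (α × Bool)) (ha : a = (p, h ++ [li x])) (hb : b = (p, h))
      (hw : HW hh p (h ++ [li x]))
  | bridge (A : Pend S E) (t1 t2 : List (α × Bool)) (hc : A.c = t1 ++ x :: t2)
      (hl : t1.length = hh A) (ha : a = (A.p, t1)) (hb : b = (A.q, invRev t2))

variable {hh : Pend S E → ℕ}

theorem Ctx.hbd (C : Ctx S E hh) (A : Pend S E) : 39 * (A.c ++ A.k).length ≤ 100 * hh A := by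
  have h1 := A.small
  have h2 := C.hS.len _ A.mem
  have h3 := C.half A
  simp only [List.length_append] at *
  omega

theorem Ctx.hpos (C : Ctx S E hh) (A : Pend S E) : 0 < hh A := by
  have h1 := C.hbd A
  have h2 := C.hS.len _ A.mem
  omega

theorem HW.head {p : V} {h : List (α × Bool)} (H : HW hh p h) :
    ∃ x t, h = x :: t ∧ ∀ z, ¬ E p x z := by
  rcases H with ⟨x, h1, h2⟩ | ⟨A, h1, h2, ⟨t, h3⟩, h4⟩
  · exact ⟨x, [], h1, h2⟩
  · obtain ⟨x, h', rfl⟩ := List.exists_cons_of_ne_nil h2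
    refine ⟨x, h', rfl, ?_⟩
    rw [← h1]
    exact A.hp x (h' ++ t) (by rw [h3]; simp)

theorem Ctx.hred (C : Ctx S E hh) {p : V} {h : List (α × Bool)} (H : HW hh p h) :
    IsReduced h := by
  rcases H with ⟨x, h1, h2⟩ | ⟨A, h1, h2, ⟨t, h3⟩, h4⟩
  · rw [h1]; exact IsReduced.singleton
  · have := C.hS.red _ A.mem
    rw [h3] at this
    exact red_left (red_left this)

theorem HW.pre {p : V} {h h' : List (α × Bool)} (H : HW hh p (h ++ h')) (hn : h ≠ []) :
    HW hh p h := by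
  rcases H with ⟨x, h1, h2⟩ | ⟨A, h1, h2, ⟨t, h3⟩, h4⟩
  · left
    refine ⟨x, ?_, h2⟩
    obtain ⟨y, h'', rfl⟩ := List.exists_cons_of_ne_nil hn
    simp at h1
    simp [h1]
  · right
    refine ⟨A, h1, hn, ⟨h' ++ t, by rw [h3]; simp⟩, ?_⟩
    simp at h4
    omega

theorem Ctx.cred (C : Ctx S E hh) (A : Pend S E) : IsReduced A.c := red_left (C.hS.red _ A.mem)

theorem Ctx.fold (C : Ctx S E hh) : Fold (EE hh) where
  symm := by
    intro a x b h
    cases h with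
    | old p q ha hb h => exact .old q p hb ha (C.hG.symm _ _ _ h)
    | up p h ha hb hw => 
      exact .down p h (by rw [hb, li_li]) ha (by rw [li_li]; exact hw)
    | down p h ha hb hw => exact .up p h hb ha hw
    | bridge A t1 t2 hc hl ha hb =>
      have hs := C.sum A
      refine .bridge (A.star C.hS C.hG.toFold) (invRev t2) (invRev t1) ?_ ?_ ?_ ?_
      · show invRev A.c = _
        rw [hc, invRev_append, invRev_cons']
        simp
      · rw [hc] at hs
        simp at hs ⊢
        omega
      · exact hb
      · rw [ha, invRev_invRev]; rfl
  det := by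
    have ub : ∀ (A : Pend S E) (t1 t2 : List (α × Bool)) (x : α × Bool), A.c = t1 ++ x :: t2 →
        t1.length = hh A → HW hh A.p (t1 ++ [x]) → False := by
      intro A t1 t2 x hc hl hw
      rcases hw with ⟨y, h1, h2⟩ | ⟨B, h1, h2, ⟨t, h3⟩, h4⟩
      · have := C.hpos A
        have h5 := congrArg List.length h1
        simp at h5
        rw [h5] at hl
        simp at hl
        omega
      · have hb := C.hbd A
        have := Pend.eq_of C.hS C.hG.toFold A B h1.symm (v := t1) (s := x :: t2) (s' := [x] ++ t) hc
          (by rw [h3]; simp) (by omega)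
        subst this
        simp at h4
        omega
    intro a x b c h1 h2
    cases h1 with
    | old p q ha hb h =>
      cases h2 with
      | old p' q' ha' hb' h' => 
        rw [ha] at ha'; cases ha'
        rw [hb, hb', C.hG.det _ _ _ _ h h']
      | up p' h' ha' hb' hw =>
        rw [ha] at ha'; cases ha'
        obtain ⟨y, t, h1, h2⟩ := hw.head
        simp at h1
        rw [h1.1] at h
        exact absurd h (h2 _)
      | down p' h' ha' hb' hw => rw [ha] at ha'; simp at ha'
      | bridge A t1 t2 hc hl ha' hb' =>
        rw [ha] at ha'; cases ha'
        have := C.hpos A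
        simp at hl; omega
    | up p h ha hb hw =>
      cases h2 with
      | old p' q' ha' hb' h' =>
        rw [ha] at ha'; cases ha'
        obtain ⟨y, t, h1, h2⟩ := hw.head
        simp at h1
        rw [h1.1] at h'
        exact absurd h' (h2 _)
      | up p' h' ha' hb' hw' => rw [ha] at ha'; cases ha'; rw [hb, hb']
      | down p' h' ha' hb' hw' =>
        rw [ha] at ha'; cases ha'
        have h3 := C.hred hw
        rw [List.append_assoc] at h3
        exact absurd (li_li x).symm (red_pair h3)
      | bridge A t1 t2 hc hl ha' hb' =>
        rw [ha] at ha'; cases ha'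
        exact (ub A _ _ _ hc hl hw).elim
    | down p h ha hb hw =>
      cases h2 with
      | old p' q' ha' hb' h' => rw [ha] at ha'; simp at ha'
      | up p' h' ha' hb' hw' =>
        rw [ha] at ha'; cases ha'
        have h3 := C.hred hw'
        rw [List.append_assoc] at h3
        exact absurd (li_li x).symm (red_pair h3)
      | down p' h' ha' hb' hw' =>
        rw [ha] at ha'
        simp at ha'
        rw [hb, hb', ha'.1, ha'.2]
      | bridge A t1 t2 hc hl ha' hb' =>
        rw [ha] at ha'; cases ha'
        have h3 := C.cred A
        rw [hc, List.append_assoc] at h3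
        exact absurd (li_li x).symm (red_pair h3)
    | bridge A t1 t2 hc hl ha hb =>
      cases h2 with
      | old p' q' ha' hb' h' =>
        rw [ha] at ha'; cases ha'
        have := C.hpos A
        simp at hl; omega
      | up p' h' ha' hb' hw' =>
        rw [ha] at ha'; cases ha'
        exact (ub A _ _ _ hc hl hw').elim
      | down p' h' ha' hb' hw' =>
        rw [ha] at ha'; cases ha'
        have h3 := C.cred A
        rw [hc, List.append_assoc] at h3
        exact absurd (li_li x).symm (red_pair h3)
      | bridge B s1 s2 hc' hl' ha' hb' =>
        rw [ha] at ha'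
        simp only [Prod.mk.injEq] at ha'
        obtain ⟨h1, rfl⟩ := ha'
        have hb3 := C.hbd A
        have := Pend.eq_of C.hS C.hG.toFold A B h1 hc hc' (by omega)
        subst this
        rw [hc] at hc'
        simp at hc'
        rw [hb, hb', hc']

theorem lift {w : List (α × Bool)} {a b : V} (h : rd E w a b) :
    rd (EE hh) w (a, []) (b, []) := by
  induction w generalizing a with
  | nil => cases h; rfl
  | cons x w ih =>
    obtain ⟨c, h1, h2⟩ := h
    exact ⟨(c, []), .old a c rfl rfl h1, ih h2⟩

theorem up_path {p : V} {h1 h2 : List (α × Bool)} (H : HW hh p (h1 ++ h2)) :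
    rd (EE hh) h2 (p, h1) (p, h1 ++ h2) := by
  induction h2 using List.reverseRecOn with
  | nil => simp [rd]
  | append_singleton h2 x ih =>
    rw [← List.append_assoc] at H ⊢
    rw [rd_append]
    refine ⟨(p, h1 ++ h2), ?_, rd_single.2 (.up p _ rfl rfl H)⟩
    by_cases hn : h1 ++ h2 = []
    · simp at hn
      simp [hn, rd]
    · exact ih (H.pre hn)

theorem up_pathA (A : Pend S E) {h1 h2 t : List (α × Bool)} (hc : A.c = h1 ++ h2 ++ t)
    (hl : (h1 ++ h2).length ≤ hh A) : rd (EE hh) h2 (A.p, h1) (A.p, h1 ++ h2) := by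
  by_cases hn : h1 ++ h2 = []
  · simp at hn
    simp [hn, rd]
  · exact up_path (Or.inr ⟨A, rfl, hn, ⟨t, hc⟩, hl⟩)

theorem Ctx.split (C : Ctx S E hh) (A : Pend S E) : ∃ t1 x t2, A.c = t1 ++ x :: t2 ∧
    t1.length = hh A := by
  have hs := C.sum A
  have h1 : hh A < A.c.length := by omega
  refine ⟨A.c.take (hh A), A.c[hh A], A.c.drop (hh A + 1), ?_, ?_⟩
  · simp
  · simp; omega

/-- the mirror -/
def Ctx.st (C : Ctx S E hh) (A : Pend S E) : Pend S E := A.star C.hS C.hG.toFold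

theorem Ctx.st_c (C : Ctx S E hh) (A : Pend S E) {t1 t2 : List (α × Bool)} {x : α × Bool}
    (hc : A.c = t1 ++ x :: t2) : (C.st A).c = invRev t2 ++ li x :: invRev t1 := by
  show invRev A.c = _
  rw [hc, invRev_append, invRev_cons']
  simp

theorem Ctx.st_l (C : Ctx S E hh) (A : Pend S E) {t1 t2 : List (α × Bool)} {x : α × Bool}
    (hc : A.c = t1 ++ x :: t2) (hl : t1.length = hh A) : (invRev t2).length = hh (C.st A) := by
  have hs := C.sum A
  rw [hc] at hs
  simp [Ctx.st] at hs ⊢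
  omega

theorem Ctx.st_len (C : Ctx S E hh) (A : Pend S E) :
    ((C.st A).c ++ (C.st A).k).length = (A.c ++ A.k).length := by
  simp [Ctx.st, Pend.star]

theorem Ctx.loop (C : Ctx S E hh) (A : Pend S E) :
    rd (EE hh) (A.c ++ A.k) (A.p, []) (A.p, []) := by
  obtain ⟨t1, x, t2, hc, hl⟩ := C.split A
  have hc' := C.st_c A hc
  have hl' := C.st_l A hc hl
  rw [rd_append]
  refine ⟨(A.q, []), ?_, lift A.path⟩
  rw [hc, rd_append]
  refine ⟨(A.p, t1), ?_, (A.q, invRev t2), .bridge A t1 t2 hc hl rfl rfl, ?_⟩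
  · have := up_pathA (hh := hh) A (h1 := []) (h2 := t1) (by simpa using hc) (by simp [hl])
    simpa using this
  · have := up_pathA (hh := hh) (C.st A) (h1 := []) (h2 := invRev t2) (by simpa using hc')
      (by simpa using hl'.le)
    have := C.fold.rd_inv this
    rw [invRev_invRev] at this
    exact this

theorem Ctx.seg (C : Ctx S E hh) (A : Pend S E) {h1 h2 t s : List (α × Bool)}
    (hc : A.c = h1 ++ h2 ++ t) (hl : (h1 ++ h2).length ≤ hh A) (hs : h2 ++ s ∈ S)
    (hb : (h2 ++ s).length ≤ 100 * h2.length ∨ (A.c ++ A.k).length ≤ 100 * h2.length) :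
    rd (EE hh) (h2 ++ s) (A.p, h1) (A.p, h1) := by
  have hm := A.mem
  have hL := C.loop A
  have hp1 := up_pathA (hh := hh) A (h1 := []) (h2 := h1) (t := h2 ++ t) (by simpa using hc)
    (by simp at hl ⊢; omega)
  simp only [List.nil_append] at hp1
  have e : A.c ++ A.k = h1 ++ (h2 ++ (t ++ A.k)) := by rw [hc]; simp
  rw [e] at hm hL
  have hL2 := C.fold.clos_rot' hp1 hL
  have hm2 := C.hS.rot _ _ hm
  rw [List.append_assoc] at hm2 hL2
  have : s = (t ++ A.k) ++ h1 := by
    rcases hb with hb | hb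
    · exact C.hS.piece _ _ _ hs hm2 hb
    · refine (C.hS.piece _ _ _ hm2 hs ?_).symm
      rw [e] at hb
      simp only [List.length_append] at hb ⊢
      omega
  rw [this]
  exact hL2

theorem Ctx.seg_down (C : Ctx S E hh) (A : Pend S E) {h1 h2 t s : List (α × Bool)}
    (hc : A.c = h1 ++ h2 ++ t) (hl : (h1 ++ h2).length ≤ hh A) (hs : invRev h2 ++ s ∈ S)
    (hb : (invRev h2 ++ s).length ≤ 100 * h2.length ∨ (A.c ++ A.k).length ≤ 100 * h2.length) :
    rd (EE hh) (invRev h2 ++ s) (A.p, h1 ++ h2) (A.p, h1 ++ h2) := by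
  have h3' : h2 ++ invRev s ∈ S := by
    have := C.hS.inv _ hs
    rw [invRev_append, invRev_invRev] at this
    exact C.hS.rot _ _ this
  have h4 := C.seg A hc hl h3' (by simpa using hb)
  have h5 := C.fold.clos_rot' (up_pathA A hc hl) h4
  have h6 := C.fold.rd_inv h5
  simpa using h6

/-- letter not going down -/
def ND (E : V → α × Bool → V → Prop) (p : V) (h : List (α × Bool)) (x : α × Bool) : Prop :=
  (∀ h', h ≠ h' ++ [li x]) ∧ (h = [] → ∀ z, ¬ E p x z)

theorem lemU {w : List (α × Bool)} {p : V} {h : List (α × Bool)}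
    {b : V × List (α × Bool)} (hw : rd (EE hh) w (p, h) b) (hr : IsReduced w)
    (hn : ∀ x w', w = x :: w' → ND E p h x) :
    (b = (p, h ++ w) ∧ (w = [] ∨ HW hh p (h ++ w))) ∨
    ∃ (A : Pend S E) (t1 t2 : List (α × Bool)) (x : α × Bool) (w1 w2 : List (α × Bool)),
      A.p = p ∧ A.c = t1 ++ x :: t2 ∧ t1.length = hh A ∧ w = w1 ++ x :: w2 ∧ h ++ w1 = t1 ∧
      rd (EE hh) (w1 ++ [x]) (p, h) (A.q, invRev t2) ∧
      rd (EE hh) w2 (A.q, invRev t2) b := by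
  induction w generalizing h with
  | nil => left; cases hw; simp
  | cons x w ih =>
    obtain ⟨c, he, hw⟩ := hw
    have hnd := hn x w rfl
    have he' := he
    cases he with
    | old p' q ha hb h' => 
      cases ha
      exact absurd h' (hnd.2 rfl q)
    | down p' h' ha hb hw' =>
      cases ha
      exact absurd rfl (hnd.1 h')
    | up p' h' ha hb hw' =>
      cases ha
      subst hb
      have hnd2 : ∀ y w', w = y :: w' → ND E p (h ++ [x]) y := by
        rintro y w' rfl
        refine ⟨?_, by simp⟩
        intro h'' h3
        simp at h3
        have := red_pair (s := []) hr
        rw [h3.2, li_li] at this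
        exact absurd rfl this
      rcases ih hw (red_tail hr) hnd2 with ⟨h1, h2⟩ | ⟨A, t1, t2, y, w1, w2, h1, h2, h3, h4, h5, h6, h7⟩
      · left
        refine ⟨by simpa using h1, Or.inr ?_⟩
        rcases h2 with rfl | h2
        · exact hw'
        · simpa using h2
      · right
        refine ⟨A, t1, t2, y, x :: w1, w2, h1, h2, h3, by simp [h4], by simpa using h5, ?_, h7⟩
        exact ⟨_, he', h6⟩
    | bridge A t1 t2 hc hl ha hb =>
      cases ha
      subst hb
      right
      exact ⟨A, _, t2, x, [], w, rfl, hc, hl, rfl, by simp, ⟨_, he', rfl⟩, hw⟩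

theorem Ctx.lemD (C : Ctx S E hh) (A : Pend S E) {w s0 t' : List (α × Bool)} {y : α × Bool}
    {b : V × List (α × Bool)} (hc : A.c = s0 ++ y :: t') (hl : s0.length ≤ hh A)
    (hw : rd (EE hh) w (A.p, s0) b) (hr : IsReduced w) (hn : ∀ w', w ≠ y :: w') :
    (∃ s, s0 = s ++ invRev w) ∨ ∃ s s' w', s0 = s ++ s' ∧ w = invRev s' ++ w' ∧
      100 * s.length < (A.c ++ A.k).length := by
  induction w generalizing s0 t' y with
  | nil => left; exact ⟨s0, by simp⟩
  | cons x w ih =>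
    obtain ⟨c, he, hw⟩ := hw
    have hxy : x ≠ y := by rintro rfl; exact hn w rfl
    by_cases hsm : 100 * s0.length < (A.c ++ A.k).length
    · right; exact ⟨s0, [], x :: w, by simp, by simp, hsm⟩
    have hs0 : s0 ≠ [] := by
      rintro rfl
      have := C.hS.len _ A.mem
      simp only [List.length_nil] at hsm
      omega
    cases he with
    | old p' q ha hb h' => cases ha; exact absurd rfl hs0
    | up p' h' ha hb hw' =>
      cases ha
      rcases hw' with ⟨z, h1, h2⟩ | ⟨B, h1, h2, ⟨t, h3⟩, h4⟩
      · have h5 := congrArg List.length h1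
        simp at h5
        exact absurd h5 hs0
      · rw [List.append_assoc] at h3
        have := Pend.eq_of C.hS C.hG.toFold A B h1.symm hc h3 (by omega)
        subst this
        rw [hc] at h3
        simp at h3
        exact absurd h3.1.symm hxy
    | bridge B t1 t2 hc' hl' ha hb =>
      simp only [Prod.mk.injEq] at ha
      obtain ⟨ha, rfl⟩ := ha
      have := Pend.eq_of C.hS C.hG.toFold A B ha hc hc' (by omega)
      subst this
      rw [hc] at hc'
      simp at hc'
      exact absurd hc'.1.symm hxy
    | down p' h' ha hb hw' =>
      cases ha
      subst hb
      have hn2 : ∀ w', w ≠ li x :: w' := by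
        rintro w' rfl
        exact red_pair (s := []) hr rfl
      rcases ih (s0 := h') (y := li x) (t' := y :: t') (by rw [hc]; simp) (by simp at hl; omega) hw
        (red_tail hr) hn2 with ⟨s, h1⟩ | ⟨s, s', w', h1, h2, h3⟩
      · left; exact ⟨s, by rw [h1, invRev_cons']; simp⟩
      · right
        refine ⟨s, s' ++ [li x], w', by rw [h1]; simp, ?_, h3⟩
        rw [invRev_concat, li_li, h2]; rfl

theorem Ctx.lemUB (C : Ctx S E hh) {w s : List (α × Bool)} {p : V} {h : List (α × Bool)}
    {b : V × List (α × Bool)} (hw : rd (EE hh) w (p, h) b)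
    (hn : ∀ x w', w = x :: w' → ND E p h x) (hs : w ++ s ∈ S) :
    rd (EE hh) (w ++ s) (p, h) (p, h) ∨ 100 * w.length ≤ 3 * (w ++ s).length := by
  have hlen := C.hS.len _ hs
  have hr : IsReduced w := red_left (C.hS.red _ hs)
  rcases lemU hw hr hn with ⟨h1, h2⟩ | ⟨A, t1, t2, x, w1, w2, h1, h2, h3, h4, h5, h6, h7⟩
  · rcases h2 with rfl | ⟨x, h2, h3⟩ | ⟨A, rfl, h2, ⟨t, h3⟩, h4⟩
    · right; simp
    · right
      have := congrArg List.length h2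
      simp only [List.length_append, List.length_singleton] at this hlen ⊢
      omega
    · by_cases hb : (w ++ s).length ≤ 100 * w.length
      · left; exact C.seg A h3 h4 hs (Or.inl hb)
      · right; omega
  · subst h1 h5 h4
    by_cases hb1 : (w1 ++ (x :: w2 ++ s)).length ≤ 100 * w1.length
    · left
      have := C.seg A (t := x :: t2) (s := x :: w2 ++ s) h2 h3.le (by simpa using hs) (Or.inl hb1)
      simpa using this
    have hc' := C.st_c A h2
    have hl' := C.st_l A h2 h3
    have hm : w2 ++ (s ++ (w1 ++ [x])) ∈ S := by
      have h8 : (w1 ++ [x]) ++ (w2 ++ s) ∈ S := by simpa using hs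
      have := C.hS.rot _ _ h8
      simpa using this
    have hr2 : ∀ w', w2 ≠ li x :: w' := by
      rintro w' rfl
      exact red_pair hr rfl
    have fin : rd (EE hh) (w2 ++ (s ++ (w1 ++ [x]))) (A.q, invRev t2) (A.q, invRev t2) →
        rd (EE hh) ((w1 ++ x :: w2) ++ s) (A.p, h) (A.p, h) := by
      intro h8
      have := C.fold.clos_rot (v := w2 ++ s) h6 (by simpa using h8)
      simpa using this
    have hrw2 : IsReduced w2 := by
      have : IsReduced ((w1 ++ [x]) ++ w2) := by simpa using hr
      exact red_right this
    rcases C.lemD (C.st A) (w := w2) hc' hl'.le h7 hrw2 hr2 with ⟨s1, h8⟩ | ⟨s1, s2, w', h8, h9, h10⟩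
    · by_cases hb2 : (w2 ++ (s ++ (w1 ++ [x]))).length ≤ 100 * w2.length
      · left
        apply fin
        have := C.seg_down (C.st A) (h1 := s1) (h2 := invRev w2) (t := li x :: invRev (h ++ w1))
          (s := s ++ (w1 ++ [x])) (by rw [hc', h8]) (by rw [← h8]; exact hl'.le)
          (by rw [invRev_invRev]; exact hm) (Or.inl (by simpa using hb2))
        rw [← h8, invRev_invRev] at this
        exact this
      · right
        simp only [List.length_append, List.length_cons, List.length_nil] at *
        omega
    · left
      apply fin
      have hbd := C.hbd (C.st A)
      have := C.seg_down (C.st A) (h1 := s1) (h2 := s2) (t := li x :: invRev (h ++ w1))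
          (s := w' ++ (s ++ (w1 ++ [x]))) (by rw [hc', h8]) (by rw [← h8]; exact hl'.le)
          (by rw [h9] at hm; simpa using hm) (Or.inr (by
            rw [← hl', h8] at hbd
            simp only [List.length_append] at *
            omega))
      rw [← h8] at this
      rw [h9, List.append_assoc]
      exact this

theorem Ctx.lemMid (C : Ctx S E hh) {u s : List (α × Bool)} {a b : V} (hs : u ++ s ∈ S)
    (hu : rd E u a b) (hb : 15 * (u ++ s).length ≤ 100 * u.length) :
    rd (EE hh) (u ++ s) (a, []) (a, []) := by
  induction hn : s.length using Nat.strong_induction_on generalizing u s a b with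
  | _ n ih =>
  by_cases h1 : ∃ x t z, s = x :: t ∧ E b x z
  · obtain ⟨x, t, z, rfl, hz⟩ := h1
    have := ih t.length (by simp at hn; omega) (u := u ++ [x]) (s := t) (a := a) (b := z)
      (by simpa using hs) (rd_append.2 ⟨b, hu, rd_single.2 hz⟩)
      (by simp only [List.length_append, List.length_cons, List.length_nil] at *; omega) rfl
    simpa using this
  by_cases h2 : ∃ x t z, s = t ++ [x] ∧ E a (li x) z
  · obtain ⟨x, t, z, rfl, hz⟩ := h2
    have hz' := C.hG.symm _ _ _ hz
    rw [li_li] at hz'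
    have hs' : [x] ++ (u ++ t) ∈ S := C.hS.rot _ _ (by simpa using hs)
    have := ih t.length (by simp at hn; omega) (u := x :: u) (s := t) (a := z) (b := b)
      (by simpa using hs') ⟨a, hz', hu⟩
      (by simp only [List.length_append, List.length_cons, List.length_nil] at *; omega) rfl
    have h3 := C.fold.clos_rot' (u := [x]) (v := u ++ t) (a := (z, [])) (b := (a, []))
      (rd_single.2 (.old z a rfl rfl hz')) (by simpa using this)
    simpa using h3
  by_cases h3 : 20 * (u ++ s).length ≤ 100 * u.length
  · exact lift (C.hG.close _ _ _ _ hs hu h3)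
  · let A : Pend S E := 
      { p := b, q := a, c := s, k := u, mem := C.hS.rot _ _ hs, path := hu
        big := by simp only [List.length_append] at *; omega
        small := by simp only [List.length_append] at *; omega
        hp := fun x t h z hz => h1 ⟨x, t, z, h, hz⟩
        hq := fun x t h z hz => h2 ⟨x, t, z, h, hz⟩ }
    exact C.fold.clos_rot (lift hu) (C.loop A)

theorem Ctx.lemDP (C : Ctx S E hh) {u : List (α × Bool)} {p : V} {h : List (α × Bool)}
    {b : V × List (α × Bool)} (hu : rd (EE hh) u (p, h) b) :
    ∃ h1 h2 u', h = h1 ++ h2 ∧ u = invRev h2 ++ u' ∧ rd (EE hh) u' (p, h1) b ∧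
      (∀ x w, u' = x :: w → ∀ h', h1 ≠ h' ++ [li x]) ∧ (h2 = [] ∨ HW hh p h) := by
  induction u generalizing h with
  | nil => exact ⟨h, [], [], by simp, by simp, hu, by simp, by simp⟩
  | cons x u ih =>
    by_cases hd : ∃ h', h = h' ++ [li x]
    · obtain ⟨h', rfl⟩ := hd
      obtain ⟨c, he, hu⟩ := hu
      cases he with
      | old p' q ha hb h' => simp at ha
      | up p' h'' ha hb hw' =>
        cases ha
        have h3 := C.hred hw'
        rw [List.append_assoc] at h3
        exact absurd (li_li x).symm (red_pair h3)
      | bridge A t1 t2 hc hl ha hb =>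
        cases ha
        have h3 := C.cred A
        rw [hc, List.append_assoc] at h3
        exact absurd (li_li x).symm (red_pair h3)
      | down p' h'' ha hb hw' =>
        simp at ha
        obtain ⟨rfl, rfl⟩ := ha
        subst hb
        obtain ⟨h1, h2, u', e1, e2, e3, e4, e5⟩ := ih hu
        refine ⟨h1, h2 ++ [li x], u', by rw [e1]; simp, ?_, e3, e4, Or.inr hw'⟩
        rw [invRev_concat, li_li, e2]; rfl
    · push Not at hd
      refine ⟨h, [], x :: u, by simp, by simp, hu, ?_, by simp⟩
      intro y w hy
      cases hy
      exact hd

theorem Ctx.lemOP (C : Ctx S E hh) {u : List (α × Bool)} {p : V}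
    {b : V × List (α × Bool)} (hu : rd (EE hh) u (p, []) b) :
    ∃ m u' p2, u = m ++ u' ∧ rd E m p p2 ∧ rd (EE hh) u' (p2, []) b ∧
      ∀ x w, u' = x :: w → ND E p2 [] x := by
  induction u generalizing p with
  | nil => exact ⟨[], [], p, rfl, rfl, hu, by simp⟩
  | cons x u ih =>
    by_cases hd : ∃ z, E p x z
    · obtain ⟨z, hz⟩ := hd
      obtain ⟨c, he, hu⟩ := hu
      cases C.fold.det _ _ _ _ he (EE.old p z rfl rfl hz)
      obtain ⟨m, u', p2, e1, e2, e3, e4⟩ := ih hu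
      exact ⟨x :: m, u', p2, by rw [e1]; rfl, ⟨z, hz, e2⟩, e3, e4⟩
    · push Not at hd
      refine ⟨[], x :: u, p, rfl, rfl, hu, ?_⟩
      intro y w hy
      cases hy
      exact ⟨by simp, fun _ => hd⟩

theorem Ctx.good (C : Ctx S E hh) : Good S (EE hh) where
  toFold := C.fold
  close := by
    rintro u t ⟨p, h⟩ b hs hu hb
    have hlen := C.hS.len _ hs
    obtain ⟨h1, h2, u', rfl, rfl, e3, e4, e5⟩ := C.lemDP hu
    by_contra hcon
    have hh2 : 100 * h2.length < ((invRev h2 ++ u') ++ t).length := by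
      by_contra hbig
      rcases e5 with rfl | ⟨x, h3, h4⟩ | ⟨A, rfl, h3, ⟨t', h4⟩, h5⟩
      · simp only [List.length_nil] at hbig; omega
      · have := congrArg List.length h3
        simp only [List.length_append, List.length_singleton] at this hlen hbig
        omega
      · apply hcon
        have := C.seg_down A (s := u' ++ t) h4 h5 (by simpa using hs) (Or.inl (by
          simp only [List.length_append] at *; omega))
        simpa using this
    have hpath : rd (EE hh) (invRev h2) (p, h1 ++ h2) (p, h1) := by
      rcases e5 with rfl | e5
      · simp [rd]
      · exact C.fold.rd_inv (up_path e5)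
    have hs2 : u' ++ (t ++ invRev h2) ∈ S := by
      have := C.hS.rot (invRev h2) (u' ++ t) (by simpa using hs)
      simpa using this
    have fin : ¬ rd (EE hh) (u' ++ (t ++ invRev h2)) (p, h1) (p, h1) := by
      intro h3
      apply hcon
      have := C.fold.clos_rot (v := u' ++ t) hpath (by simpa using h3)
      simpa using this
    by_cases hn : h1 = []
    · subst hn
      obtain ⟨m, u'', p2, rfl, f2, f3, f4⟩ := C.lemOP e3
      have hs3 : u'' ++ (t ++ invRev h2 ++ m) ∈ S := by
        have := C.hS.rot m (u'' ++ (t ++ invRev h2)) (by simpa using hs2)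
        simpa using this
      rcases C.lemUB f3 f4 hs3 with h6 | h6
      · apply fin
        have := C.fold.clos_rot (u := m) (v := u'' ++ (t ++ invRev h2)) (lift f2) (by simpa using h6)
        simpa using this
      · by_cases hm : 15 * (m ++ (u'' ++ (t ++ invRev h2))).length ≤ 100 * m.length
        · apply fin
          have := C.lemMid (s := u'' ++ (t ++ invRev h2)) (by simpa using hs2) f2 hm
          simpa using this
        · simp only [List.length_append, invRev_length] at *
          omega
    · rcases C.lemUB e3 (fun x w hx => ⟨e4 x w hx, fun h => absurd h hn⟩) hs2 with h6 | h6
      · exact fin h6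
      · simp only [List.length_append, invRev_length] at *
        omega

/-- contains a big part of a relator -/
def Big (S : Set (List (α × Bool))) (w : List (α × Bool)) : Prop :=
  ∃ u v, u ++ v ∈ S ∧ 70 * (u ++ v).length ≤ 100 * u.length ∧ u <:+: w

theorem Ctx.lemJ (C : Ctx S E hh) {w : List (α × Bool)} {p p' : V}
    (hw : rd (EE hh) w (p, []) (p', [])) (hr : IsReduced w) : rd E w p p' ∨ Big S w := by
  obtain ⟨m, w', p2, rfl, f2, f3, f4⟩ := C.lemOP hw
  have hr' := red_right hr
  rcases lemU f3 hr' f4 with ⟨h1, h2⟩ | ⟨A, t1, t2, x, w1, w2, rfl, h2, h3, rfl, h5, h6, h7⟩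
  · left
    simp at h1
    obtain ⟨rfl, rfl⟩ := h1
    simpa using f2
  · right
    simp only [List.nil_append] at h5
    subst h5
    have hc' := C.st_c A h2
    have hl' := C.st_l A h2 h3
    have hr2 : ∀ w', w2 ≠ li x :: w' := by
      rintro w' rfl
      exact red_pair hr' rfl
    have hrw2 : IsReduced w2 := by
      have : IsReduced ((w1 ++ [x]) ++ w2) := by simpa using hr'
      exact red_right this
    have hsm := A.small
    have hm := A.mem
    have hle := C.hS.len _ hm
    rcases C.lemD (C.st A) (w := w2) hc' hl'.le h7 hrw2 hr2 with ⟨s1, h8⟩ | ⟨s1, s2, w', h8, h9, h10⟩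
    · have hp := up_pathA (hh := hh) (C.st A) (h1 := s1) (h2 := invRev w2) (t := li x :: invRev w1)
        (by rw [hc', h8]) (by rw [← h8]; exact hl'.le)
      have hp2 := C.fold.rd_inv hp
      rw [invRev_invRev, ← h8] at hp2
      have h9 := C.fold.rd_det h7 hp2
      simp only [Prod.mk.injEq] at h9
      have h10 := h9.2
      subst h10
      have h11 : t2 = w2 := by
        have := congrArg invRev h8
        simpa using this
      subst h11
      refine ⟨A.c, A.k, hm, ?_, ⟨m, [], by rw [h2]; simp⟩⟩
      simp only [List.length_append] at *
      omega
    · have h11 : t2 = invRev s2 ++ invRev s1 := by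
        have := congrArg invRev h8
        simpa using this
      have e : A.c ++ A.k = (w1 ++ x :: invRev s2) ++ (invRev s1 ++ A.k) := by
        rw [h2, h11]; simp
      rw [C.st_len] at h10
      refine ⟨w1 ++ x :: invRev s2, invRev s1 ++ A.k, ?_, ?_, ⟨m, w', by rw [h9]; simp⟩⟩
      · rw [← e]; exact hm
      · rw [← e]
        rw [e] at h10 hle hsm
        rw [e]
        simp only [List.length_append, List.length_cons, invRev_length] at *
        omega

end step

section green

variable {S : Set (List (α × Bool))}

theorem stage (hS : SC S) (n : ℕ) : ∃ (V : Type) (E : V → α × Bool → V → Prop) (o : V),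
    Good S E ∧ (∀ w : List (α × Bool), w.length ≤ n → ∃ b, rd E w o b) ∧
    ∀ w, IsReduced w → rd E w o o → w = [] ∨ Big S w := by
  induction n with
  | zero =>
    refine ⟨Unit, fun _ _ _ => False, (), ?_, ?_, ?_⟩
    · refine { symm := by simp, det := by simp, close := ?_ }
      intro u t a b hs hu hb
      cases u with
      | nil =>
        have := hS.len _ hs
        simp at this hb
        simp [hb] at this
      | cons x u => obtain ⟨c, h, _⟩ := hu; exact h.elim
    · intro w hw
      have : w = [] := by simpa using hw
      exact ⟨(), by rw [this]; rfl⟩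
    · intro w _ hw
      cases w with
      | nil => exact Or.inl rfl
      | cons x u => obtain ⟨c, h, _⟩ := hw; exact h.elim
  | succ n ih =>
    obtain ⟨V, E, o, hG, h1, h2⟩ := ih
    obtain ⟨hh, h3, h4⟩ := exists_hh hS hG.toFold
    have C : Ctx S E hh := ⟨hS, hG, h3, h4⟩
    refine ⟨V × List (α × Bool), EE hh, (o, []), C.good, ?_, ?_⟩
    · intro w hw
      rcases List.eq_nil_or_concat w with rfl | ⟨w', x, rfl⟩
      · exact ⟨_, rfl⟩
      · rw [List.concat_eq_append] at hw ⊢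
        obtain ⟨b, hb⟩ := h1 w' (by simp at hw; omega)
        by_cases hz : ∃ z, E b x z
        · obtain ⟨z, hz⟩ := hz
          exact ⟨_, rd_append.2 ⟨_, lift hb, rd_single.2 (.old b z rfl rfl hz)⟩⟩
        · push Not at hz
          exact ⟨_, rd_append.2 ⟨_, lift hb, rd_single.2
            (.up b [] rfl rfl (Or.inl ⟨x, rfl, hz⟩))⟩⟩
    · intro w hr hw
      rcases C.lemJ hw hr with h | h
      · exact h2 w hr h
      · exact Or.inr h

/-- elements acting trivially on all good graphs -/
def KK (S : Set (List (α × Bool))) : Subgroup (FreeGroup α) where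
  carrier := {g | ∃ W, FreeGroup.mk W = g ∧ ∀ (V : Type) (E : V → α × Bool → V → Prop),
    Good S E → ∀ a b, rd E W a b → a = b}
  one_mem' := ⟨[], rfl, fun _ _ _ _ _ h => h⟩
  mul_mem' := by
    rintro _ _ ⟨W, rfl, h⟩ ⟨W', rfl, h'⟩
    refine ⟨W ++ W', mul_mk.symm, ?_⟩
    intro V E hG a b hw
    obtain ⟨c, h1, h2⟩ := rd_append.1 hw
    exact (h V E hG _ _ h1).trans (h' V E hG _ _ h2)
  inv_mem' := by
    rintro _ ⟨W, rfl, h⟩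
    refine ⟨invRev W, inv_mk.symm, ?_⟩
    intro V E hG a b hw
    have := hG.toFold.rd_inv hw
    rw [invRev_invRev] at this
    exact (h V E hG _ _ this).symm

theorem le_KK : Subgroup.normalClosure (FreeGroup.mk '' S) ≤ KK S := by
  have : (KK S).Normal := by
    constructor
    rintro _ ⟨W, rfl, h⟩ g
    obtain ⟨L, rfl⟩ := Quot.exists_rep g
    refine ⟨L ++ W ++ invRev L, ?_, ?_⟩
    · rw [← mul_mk, ← mul_mk, ← inv_mk]; rfl
    · intro V E hG a b hw
      obtain ⟨c, h1, h2⟩ := rd_append.1 hw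
      obtain ⟨d, h3, h4⟩ := rd_append.1 h1
      cases h V E hG _ _ h4
      have := hG.toFold.rd_inv h2
      rw [invRev_invRev] at this
      exact hG.toFold.rd_back h3 this
  apply Subgroup.normalClosure_le_normal
  rintro _ ⟨r, hr, rfl⟩
  refine ⟨r, rfl, ?_⟩
  intro V E hG a b hw
  have h1 := hG.close r [] a b (by simpa using hr) hw (by simp; omega)
  rw [List.append_nil] at h1
  exact hG.toFold.rd_det h1 hw

theorem greendlinger (hS : SC S) {w : List (α × Bool)} (hr : IsReduced w) (hn : w ≠ [])
    (hw : FreeGroup.mk w ∈ Subgroup.normalClosure (FreeGroup.mk '' S)) : Big S w := by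
  classical
  obtain ⟨W, h1, h2⟩ := le_KK hw
  obtain ⟨V, E, o, hG, h3, h4⟩ := stage hS W.length
  obtain ⟨b, hb⟩ := h3 W le_rfl
  cases h2 V E hG _ _ hb
  have h5 : Red W w := by
    have := reduce.red (L := W)
    rwa [reduce.sound h1, hr.reduce_eq] at this
  exact (h4 w hr (hG.toFold.rd_red h5 hb)).resolve_left hn

theorem red_app {u v : List (α × Bool)} (hu : IsReduced u) (hv : IsReduced v)
    (h : ∀ u' a b v', u = u' ++ [a] → v = b :: v' → b ≠ li a) : IsReduced (u ++ v) := by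
  refine List.isChain_append.2 ⟨hu, hv, ?_⟩
  intro a ha b hb hab
  rcases List.eq_nil_or_concat u with rfl | ⟨u', a', rfl⟩
  · simp at ha
  cases v with
  | nil => simp at hb
  | cons b' v' =>
    simp at ha hb
    subst ha hb
    have := h u' a' b' v' (by simp) rfl
    by_contra hne
    apply this
    refine Prod.ext hab.symm ?_
    simp only [li]
    revert hne
    cases a'.2 <;> cases b'.2 <;> simp

theorem red_rep (p : ℕ) (x : α × Bool) : IsReduced (List.replicate p x) := by
  refine List.isChain_replicate_of_rel p ?_
  simp

theorem mk_rep (p : ℕ) (x : α × Bool) :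
    FreeGroup.mk (List.replicate p x) = FreeGroup.mk [x] ^ p := by
  induction p with
  | zero => rfl
  | succ p ih => rw [List.replicate_succ', ← mul_mk, ih, pow_succ]

theorem red_invRev {u : List (α × Bool)} (h : IsReduced u) : IsReduced (invRev u) := by
  classical
  rw [isReduced_iff_reduce_eq, reduce_invRev, h.reduce_eq]

theorem inf_rep {u : List (α × Bool)} {p : ℕ} {x : α × Bool} (h : u <:+: List.replicate p x) :
    u = List.replicate u.length x := by
  rw [List.eq_replicate_iff]
  refine ⟨rfl, fun b hb => ?_⟩
  exact List.eq_of_mem_replicate (h.subset hb)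

theorem cut {u A B : List (α × Bool)} (h : u <:+: A ++ B) : ∃ u1 u2, u = u1 ++ u2 ∧ u1 <:+: A ∧
    u2 <:+: B ∧ (u1 = [] ∨ u2 <+: B) := by
  rcases List.infix_append_iff.1 h with h | h | ⟨l1, l2, h1, h2, h3⟩
  · exact ⟨u, [], by simp, h, List.nil_infix, Or.inr List.nil_prefix⟩
  · exact ⟨[], u, by simp, List.nil_infix, h, Or.inl rfl⟩
  · exact ⟨l1, l2, h1, h2.isInfix, h3.isInfix, Or.inr h3⟩

theorem cutp {u A B : List (α × Bool)} (h : u <+: A ++ B) : ∃ u1 u2, u = u1 ++ u2 ∧ u1 <:+: A ∧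
    u2 <:+: B ∧ (u2 = [] ∨ u1 = A) := by
  obtain ⟨t, ht⟩ := h
  rcases List.append_eq_append_iff.1 ht with ⟨a, h1, h2⟩ | ⟨a, h1, h2⟩
  · exact ⟨u, [], by simp, ⟨[], a, by simp [h1]⟩, List.nil_infix, Or.inl rfl⟩
  · exact ⟨A, a, h1, List.infix_rfl, ⟨[], t, by simp [h2]⟩, Or.inr rfl⟩

theorem cut4 {u A B C D : List (α × Bool)} (h : u <:+: A ++ (B ++ (C ++ D))) :
    ∃ u1 u2 u3 u4, u = u1 ++ (u2 ++ (u3 ++ u4)) ∧ u1 <:+: A ∧ u2 <:+: B ∧ u3 <:+: C ∧ u4 <:+: D ∧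
      (u1 = [] ∨ u3 = [] ∨ u2 = B) := by
  obtain ⟨u1, u', rfl, h1, h2, h3⟩ := cut h
  have : ∃ u2 u'', u' = u2 ++ u'' ∧ u2 <:+: B ∧ u'' <:+: C ++ D ∧ (u1 = [] ∨ u'' = [] ∨ u2 = B) := by
    rcases h3 with h3 | h3
    · obtain ⟨u2, u'', e, h4, h5, h6⟩ := cut h2
      exact ⟨u2, u'', e, h4, h5, Or.inl h3⟩
    · obtain ⟨u2, u'', e, h4, h5, h6⟩ := cutp h3
      exact ⟨u2, u'', e, h4, h5, Or.inr h6⟩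
  obtain ⟨u2, u'', rfl, h4, h5, h6⟩ := this
  obtain ⟨u3, u4, rfl, h7, h8, h9⟩ := cut h5
  refine ⟨u1, u2, u3, u4, rfl, h1, h4, h7, h8, ?_⟩
  rcases h6 with h6 | h6 | h6
  · exact Or.inl h6
  · simp at h6; exact Or.inr (Or.inl h6.1)
  · exact Or.inr (Or.inr h6)

theorem core {Q : Type} [Group Q] (φ : FreeGroup α →* Q) (hS : SC S)
    (hφ : ∀ g, φ g = 1 ↔ g ∈ Subgroup.normalClosure (FreeGroup.mk '' S))
    (hpow : ∀ r ∈ S, ∀ (z : α × Bool) (p : ℕ), List.replicate p z <:+: r → 100 * p < r.length)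
    (x y : α × Bool) (hxy : x.1 ≠ y.1) (N : ℕ) : ∀ (T : List (α × Bool)), T.length = N →
    ∀ p q : ℕ, 0 < p → 0 < q →
    φ (FreeGroup.mk T) * φ (FreeGroup.mk [x]) ^ p * (φ (FreeGroup.mk T))⁻¹ *
      φ (FreeGroup.mk [y]) ^ q ≠ 1 := by
  induction N using Nat.strong_induction_on with
  | _ N ih =>
  intro T hT p q hp hq hbad
  have ih' : ∀ T' : List (α × Bool), T'.length < T.length →
      φ (FreeGroup.mk T') * φ (FreeGroup.mk [x]) ^ p * (φ (FreeGroup.mk T'))⁻¹ *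
      φ (FreeGroup.mk [y]) ^ q ≠ 1 := fun T' h => ih _ (hT ▸ h) T' rfl p q hp hq
  -- `T` is reduced
  have hred : IsReduced T := by
    rw [isReduced_iff_not_step]
    intro L hL
    refine ih' L (by have := hL.length; omega) ?_
    have : FreeGroup.mk T = FreeGroup.mk L := Quot.sound hL
    rw [← this]; exact hbad
  have hli : ∀ z : α × Bool, FreeGroup.mk [li z] = (FreeGroup.mk [z])⁻¹ := by
    intro z; rw [inv_mk, invRev_single]
  have hend : ∀ T' z, T = T' ++ [z] → z.1 ≠ x.1 := by
    intro T' z hTz hz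
    apply ih' T' (by rw [hTz]; simp)
    have hz' : z = x ∨ z = li x := by
      rcases x with ⟨a, b⟩
      rcases z with ⟨a', b'⟩
      simp only [li] at hz ⊢
      subst hz
      cases b <;> cases b' <;> simp
    rw [hTz, ← mul_mk, MonoidHom.map_mul] at hbad
    rcases hz' with rfl | rfl
    · rw [← hbad]; group
    · rw [hli, MonoidHom.map_inv] at hbad
      rw [← hbad]; group
  have hbeg : ∀ T' z, T = z :: T' → z.1 ≠ y.1 := by
    intro T' z hTz hz
    apply ih' T' (by rw [hTz]; simp)
    have hz' : z = y ∨ z = li y := by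
      rcases y with ⟨a, b⟩
      rcases z with ⟨a', b'⟩
      simp only [li] at hz ⊢
      subst hz
      cases b <;> cases b' <;> simp
    have e : T = [z] ++ T' := hTz
    rw [e, ← mul_mk, MonoidHom.map_mul] at hbad
    have key : ∀ c t g h : Q, c * t * g * (c * t)⁻¹ * h = 1 → c⁻¹ * h * c = h →
        t * g * t⁻¹ * h = 1 := by
      intro c t g h h1 h2
      have h3 : t * g * t⁻¹ * (c⁻¹ * h * c) = c⁻¹ * (c * t * g * (c * t)⁻¹ * h) * c := by group
      rw [h2, h1] at h3
      rw [h3]; group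
    refine key _ _ _ _ hbad ?_
    rcases hz' with rfl | rfl
    · group
    · rw [hli, MonoidHom.map_inv]; group
  have hmaj : ∀ s s', s <:+: T → s ++ s' ∈ S → s.length ≤ s'.length := by
    rintro s s' ⟨T1, T2, hs⟩ hS'
    by_contra hlt
    apply ih' (T1 ++ invRev s' ++ T2) (by rw [← hs]; simp; omega)
    have h1 : φ (FreeGroup.mk (s ++ s')) = 1 :=
      (hφ _).2 (Subgroup.subset_normalClosure ⟨_, hS', rfl⟩)
    have h2 : φ (FreeGroup.mk (T1 ++ invRev s' ++ T2)) = φ (FreeGroup.mk T) := by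
      rw [← mul_mk, MonoidHom.map_mul] at h1
      rw [← hs, ← mul_mk, ← mul_mk, ← mul_mk, ← mul_mk, ← inv_mk]
      simp only [MonoidHom.map_mul, MonoidHom.map_inv]
      rw [eq_inv_of_mul_eq_one_left h1]
    rw [h2]; exact hbad
  -- take a large power
  let M := T.length + 1
  have hbadM : φ (FreeGroup.mk T) * φ (FreeGroup.mk [x]) ^ (p * M) * (φ (FreeGroup.mk T))⁻¹ *
      φ (FreeGroup.mk [y]) ^ (q * M) = 1 := by
    have h1 := eq_inv_of_mul_eq_one_left hbad
    have h2 : (φ (FreeGroup.mk T) * φ (FreeGroup.mk [x]) ^ p * (φ (FreeGroup.mk T))⁻¹) ^ M =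
        ((φ (FreeGroup.mk [y]) ^ q)⁻¹) ^ M := by rw [h1]
    rw [conj_pow, inv_pow, ← pow_mul, ← pow_mul] at h2
    rw [h2]; simp
  have hPM : T.length < p * M := by
    have : M ≤ p * M := Nat.le_mul_of_pos_left _ hp
    omega
  have hQM : 0 < q * M := Nat.mul_pos hq (by omega)
  generalize p * M = P at *
  generalize q * M = Q' at *
  have hw : FreeGroup.mk (T ++ (List.replicate P x ++ (invRev T ++ List.replicate Q' y))) ∈
      Subgroup.normalClosure (FreeGroup.mk '' S) := by
    rw [← hφ, ← mul_mk, ← mul_mk, ← mul_mk, mk_rep, mk_rep, ← inv_mk]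
    simp only [MonoidHom.map_mul, MonoidHom.map_inv, MonoidHom.map_pow]
    rw [← hbadM]; group
  have hrw : IsReduced (T ++ (List.replicate P x ++ (invRev T ++ List.replicate Q' y))) := by
    have r1 : IsReduced (invRev T ++ List.replicate Q' y) := by
      refine red_app (red_invRev hred) (red_rep _ _) ?_
      intro u' a b v' h1 h2 h3
      have h4 := congrArg invRev h1
      rw [invRev_invRev, invRev_concat] at h4
      have hb : b = y := List.eq_of_mem_replicate (n := Q') (by rw [h2]; simp)
      rw [hb] at h3
      exact hbeg _ _ h4 (by rw [h3])
    have r2 : IsReduced (List.replicate P x ++ (invRev T ++ List.replicate Q' y)) := by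
      refine red_app (red_rep _ _) r1 ?_
      intro u' a b v' h1 h2 h3
      have ha : a = x := List.eq_of_mem_replicate (n := P) (by rw [h1]; simp)
      subst ha
      rcases hi : invRev T with _ | ⟨c, t⟩
      · rw [hi] at h2
        have hb : b = y := List.eq_of_mem_replicate (n := Q') (by 
          rw [List.nil_append] at h2
          rw [h2]; simp)
        rw [hb] at h3
        exact hxy (by rw [h3]; rfl)
      · have h4 := congrArg invRev hi
        rw [invRev_invRev, invRev_cons'] at h4
        rw [hi] at h2
        simp at h2
        have := hend _ _ h4
        rw [h2.1, h3] at this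
        exact this rfl
    refine red_app hred r2 ?_
    intro u' a b v' h1 h2 h3
    have hb : b = x := by
      obtain ⟨P', rfl⟩ : ∃ P', P = P' + 1 := ⟨P - 1, by omega⟩
      rw [List.replicate_succ] at h2
      simp at h2
      exact h2.1.symm
    refine hend _ _ h1 ?_
    rw [← hb, h3]; rfl
  have hne : T ++ (List.replicate P x ++ (invRev T ++ List.replicate Q' y)) ≠ [] := by
    intro h
    have := congrArg List.length h
    simp at this
    omega
  obtain ⟨u, v, h1, h2, h3⟩ := greendlinger hS hrw hne hw
  obtain ⟨u1, u2, u3, u4, rfl, e1, e2, e3, e4, e5⟩ := cut4 h3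
  have l2 := hpow _ h1 x u2.length (by
    rw [← inf_rep e2]; exact ⟨u1, u3 ++ u4 ++ v, by simp⟩)
  have l4 := hpow _ h1 y u4.length (by
    rw [← inf_rep e4]; exact ⟨u1 ++ u2 ++ u3, v, by simp⟩)
  have l1 := hmaj u1 (u2 ++ (u3 ++ u4) ++ v) e1 (by simpa using h1)
  have hm3 : invRev u3 ++ invRev (u4 ++ v ++ (u1 ++ u2)) ∈ S := by
    have h4 := hS.rot (u1 ++ u2) (u3 ++ u4 ++ v) (by simpa using h1)
    have h5 : u3 ++ (u4 ++ v ++ (u1 ++ u2)) ∈ S := by simpa using h4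
    have h6 := hS.inv _ h5
    rw [invRev_append] at h6
    exact hS.rot _ _ h6
  have e3' : invRev u3 <:+: T := by
    obtain ⟨s, t, hst⟩ := e3
    refine ⟨invRev t, invRev s, ?_⟩
    have := congrArg invRev hst
    simpa using this
  have l3 := hmaj _ _ e3' hm3
  have k1 := e1.length_le
  have k3 := e3.length_le
  have hlen := hS.len _ h1
  simp only [List.length_append, invRev_length] at *
  rcases e5 with rfl | rfl | rfl
  · simp only [List.length_nil] at *; omega
  · simp only [List.length_nil] at *; omega
  · simp only [List.length_replicate] at *
    omega

end green

section final

theorem sc_of {k : ℕ} {lam : ℝ} (hlam0 : 0 < lam) (hlam : lam ≤ 1 / 100)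
    {R : Set (FreeGroup (Fin k))} (hR : CPrime lam R)
    (hlen : ∀ r ∈ R, 2 / lam + 1 ≤ (r.toWord.length : ℝ)) : SC (toWord '' R) where
  rot := by
    rintro u v ⟨r, hr, h⟩
    have h1 := hR.1.2.1 r hr u.length
    rw [h, List.rotate_append_length_eq] at h1
    have h2 := hR.1.1 r hr
    have h3 : IsReduced (u ++ v) := by rw [← h]; exact isReduced_toWord
    refine ⟨_, h1, ?_⟩
    rw [toWord_mk]
    refine IsReduced.reduce_eq (red_app (red_right h3) (red_left h3) ?_)
    intro v' a b u' e1 e2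
    refine h2 b a ?_ ?_
    · rw [h, e2]; simp
    · rw [h, e1]; simp
  inv := by
    rintro _ ⟨r, hr, rfl⟩
    exact ⟨r⁻¹, hR.1.2.2 r hr, toWord_inv _⟩
  red := by
    rintro _ ⟨r, hr, rfl⟩
    exact isReduced_toWord
  len := by
    rintro _ ⟨r, hr, rfl⟩
    have h1 := hlen r hr
    have h2 : 200 ≤ 2 / lam := by
      rw [le_div_iff₀ hlam0]; linarith
    have h3 : (201 : ℝ) ≤ (r.toWord.length : ℝ) := by linarith
    exact_mod_cast h3
  piece := by
    rintro u v v' ⟨r, hr, h⟩ ⟨r', hr', h'⟩ hl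
    by_contra hne
    have hp : IsPiece R u := by
      refine ⟨r, hr, r', hr', ?_, ⟨v, h.symm⟩, ⟨v', h'.symm⟩⟩
      rintro rfl
      rw [h] at h'
      exact hne (List.append_cancel_left h')
    have h1 := hR.2 u hp r hr ⟨[], v, by rw [h]; simp⟩
    rw [h] at h1
    have h2 : ((u ++ v).length : ℝ) ≤ 100 * (u.length : ℝ) := by exact_mod_cast hl
    have h3 : (0 : ℝ) ≤ ((u ++ v).length : ℝ) := by positivity
    nlinarith

theorem zpow_word {k : ℕ} {R : Set (FreeGroup (Fin k))} (i : Fin k) {m : ℤ} (hm : m ≠ 0) :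
    ∃ (b : Bool) (p : ℕ), 0 < p ∧ (PresentedGroup.of (rels := R) i) ^ m =
      PresentedGroup.mk R (FreeGroup.mk [(i, b)]) ^ p := by
  have hf : FreeGroup.mk [(i, false)] = (FreeGroup.of i)⁻¹ := rfl
  rcases lt_or_gt_of_ne hm with h | h
  · refine ⟨false, m.natAbs, by omega, ?_⟩
    rw [hf, MonoidHom.map_inv]
    have : m = -(m.natAbs : ℤ) := by omega
    conv_lhs => rw [this]
    rw [zpow_neg, zpow_natCast, inv_pow]; rfl
  · refine ⟨true, m.natAbs, by omega, ?_⟩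
    have : m = (m.natAbs : ℤ) := by omega
    conv_lhs => rw [this]
    rw [zpow_natCast]; rfl

end final

end SCG

theorem statement5 (k : ℕ) (lam : ℝ) (hlam0 : 0 < lam) (hlam : lam ≤ 1 / 100)
    (R : Set (FreeGroup (Fin k))) (hR : CPrime lam R)
    (hlen : ∀ r ∈ R, 2 / lam + 1 ≤ (r.toWord.length : ℝ))
    (hpow : ∀ r ∈ R, ∀ s : Fin k, ∀ b : Bool, ∀ p : ℕ,
      Subword (List.replicate p (s, b)) r.toWord →
        (p : ℝ) < lam * (r.toWord.length : ℝ)) :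
    ∀ i j : Fin k, i ≠ j → ∀ m n : ℤ, m ≠ 0 → n ≠ 0 →
      ¬ IsConj ((PresentedGroup.of (rels := R) i) ^ m)
          ((PresentedGroup.of (rels := R) j) ^ n) := by
  intro i j hij m n hm hn hconj
  have hS := SCG.sc_of hlam0 hlam hR hlen
  obtain ⟨c, hc⟩ := isConj_iff.1 hconj
  obtain ⟨t, rfl⟩ := PresentedGroup.mk_surjective R c
  obtain ⟨b, p, hp, h1⟩ := SCG.zpow_word (R := R) i hm
  obtain ⟨b', q, hq, h2⟩ := SCG.zpow_word (R := R) j (neg_ne_zero.2 hn)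
  have himg : FreeGroup.mk '' (FreeGroup.toWord '' R) = R := by
    ext g
    constructor
    · rintro ⟨_, ⟨r, hr, rfl⟩, rfl⟩
      rw [FreeGroup.mk_toWord]; exact hr
    · intro hg
      exact ⟨_, ⟨g, hg, rfl⟩, FreeGroup.mk_toWord⟩
  refine SCG.core (S := FreeGroup.toWord '' R) (PresentedGroup.mk R) hS ?_ ?_ (i, b) (j, b') hij _
    t.toWord rfl p q hp hq ?_
  · intro g
    rw [himg]
    exact PresentedGroup.mk_eq_one_iff
  · rintro _ ⟨r, hr, rfl⟩ ⟨s, e⟩ d ⟨u, v, huv⟩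
    have h3 := hpow r hr s e d ⟨u, v, huv.symm⟩
    have h4 : (0 : ℝ) ≤ (r.toWord.length : ℝ) := by positivity
    have h5 : 100 * (d : ℝ) < (r.toWord.length : ℝ) := by nlinarith
    exact_mod_cast h5
  · rw [FreeGroup.mk_toWord, ← h1, ← h2, hc, zpow_neg, mul_inv_cancel]
end

section
/- Let F = F(A) be the free group on A = {a_1,…,a_k} with k ≥ 2 and let m ≥ 1. The set of m-tuples (u_1,…,u_m) ∈ C_{m,A} such that no u_i is a proper power in F is exponentially generic in C_{m,A}. -/
/-!
STATEMENT 9: for k ≥ 2, m ≥ 1, the set of m-tuples in C_{m,A} no entry of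
which is a proper power in F(A) is exponentially generic in C_{m,A}.
-/

/-- The length of the freely reduced word representing `g`. -/
def wlen {α : Type} [DecidableEq α] (g : FreeGroup α) : ℕ := g.toWord.length

/-- `C_{m,A}`: the set of `m`-tuples of cyclically reduced words in the free
group of rank `k`, all entries of equal length. -/
def Cset (k m : ℕ) : Set (Fin m → FreeGroup (Fin k)) :=
  {T | (∀ i, CyclicallyReduced (T i)) ∧ ∀ i j, wlen (T i) = wlen (T j)}

/-- `γ_A(n,U)`: the number of tuples in `U` all of whose entries have length `n`. -/
noncomputable def gammaA {k m : ℕ} (U : Set (Fin m → FreeGroup (Fin k))) (n : ℕ) : ℕ :=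
  Set.ncard {T | T ∈ U ∧ ∀ i, wlen (T i) = n}

/-- `U` is an exponentially generic subset of `C_{m,A}`:
`γ(n,U)/γ(n,C_{m,A}) → 1` exponentially fast. -/
def ExpGenericIn {k m : ℕ} (U : Set (Fin m → FreeGroup (Fin k))) : Prop :=
  U ⊆ Cset k m ∧ ∃ C : ℝ, 0 < C ∧ ∃ q : ℝ, 0 < q ∧ q < 1 ∧
    ∀ n : ℕ, |((gammaA U n : ℝ) / (gammaA (Cset k m) n : ℝ)) - 1| ≤ C * q ^ n

namespace PP
open FreeGroup

/-- reduced words of length `n` -/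
def S (k : ℕ) : ℕ → Finset (List (Fin k × Bool))
  | 0 => {[]}
  | n + 1 => (S k n).biUnion fun L =>
      (Finset.univ.filter fun a : Fin k × Bool =>
        ∀ b, L.head? = some b → a ≠ (b.1, !b.2)).image (fun a => a :: L)

lemma isReduced_cons_iff {k : ℕ} (a : Fin k × Bool) (L : List (Fin k × Bool)) :
    IsReduced (a :: L) ↔ (∀ b, L.head? = some b → a ≠ (b.1, !b.2)) ∧ IsReduced L := by
  have key : ∀ b : Fin k × Bool, (a.1 = b.1 → a.2 = b.2) ↔ a ≠ (b.1, !b.2) := by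
    rintro ⟨b, y⟩
    obtain ⟨a, x⟩ := a
    cases x <;> cases y <;> simp
  cases L with
  | nil => simp
  | cons b L => simp only [isReduced_cons_cons, key]; simp

lemma mem_S {k : ℕ} (n : ℕ) (L : List (Fin k × Bool)) :
    L ∈ S k n ↔ IsReduced L ∧ L.length = n := by
  induction n generalizing L with
  | zero =>
    simp only [S, Finset.mem_singleton, List.length_eq_zero_iff]
    constructor
    · rintro rfl; simp
    · exact fun h => h.2
  | succ n ih =>
    simp only [S, Finset.mem_biUnion, Finset.mem_image, Finset.mem_filter, Finset.mem_univ,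
      true_and, ih]
    constructor
    · rintro ⟨L', ⟨h1, h2⟩, a, ha, rfl⟩
      exact ⟨(isReduced_cons_iff _ _).2 ⟨ha, h1⟩, by simp [h2]⟩
    · rintro ⟨h1, h2⟩
      cases L with
      | nil => simp at h2
      | cons a L =>
        have := (isReduced_cons_iff _ _).1 h1
        exact ⟨L, ⟨this.2, by simpa using h2⟩, a, this.1, rfl⟩

lemma card_S_succ {k : ℕ} (n : ℕ) : (S k (n+1)).card = ∑ L ∈ S k n,
    (Finset.univ.filter fun a : Fin k × Bool =>
        ∀ b, L.head? = some b → a ≠ (b.1, !b.2)).card := by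
  rw [S, Finset.card_biUnion]
  · refine Finset.sum_congr rfl fun L _ => ?_
    apply Finset.card_image_of_injective
    intro a b h
    exact (List.cons.inj h).1
  · intro L _ L' _ h
    rw [Function.onFun, Finset.disjoint_left]
    intro x hx hx'
    simp only [Finset.mem_image] at hx hx'
    obtain ⟨a, _, rfl⟩ := hx
    obtain ⟨b, _, hb⟩ := hx'
    exact h (List.cons.inj hb).2.symm

lemma card_S {k : ℕ} (n : ℕ) : (S k (n+1)).card = 2 * k * (2 * k - 1) ^ n := by
  induction n with
  | zero => rw [card_S_succ]; simp [S, mul_comm]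
  | succ n ih =>
    rw [card_S_succ, Finset.sum_const_nat (m := 2 * k - 1), ih, pow_succ, mul_assoc]
    intro L hL
    rw [mem_S] at hL
    cases L with
    | nil => simp at hL
    | cons b L =>
      have : (Finset.univ.filter fun a : Fin k × Bool =>
        ∀ c, (b :: L).head? = some c → a ≠ (c.1, !c.2)) = Finset.univ.erase (b.1, !b.2) := by
        ext a; simp
      rw [this, Finset.card_erase_of_mem (Finset.mem_univ _)]
      simp [mul_comm]

lemma card_S_le {k : ℕ} (hk : 2 ≤ k) (n : ℕ) : (S k n).card ≤ 2 * k * (2 * k - 1) ^ n := by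
  cases n with
  | zero => simp [S]; omega
  | succ n =>
    rw [card_S]
    gcongr <;> omega

lemma le_card_S {k : ℕ} (hk : 2 ≤ k) (n : ℕ) : (2 * k - 1) ^ n ≤ (S k n).card := by
  cases n with
  | zero => simp [S]
  | succ n =>
    rw [card_S, pow_succ, mul_comm]
    gcongr; omega

open Classical in
/-- cyclically reduced elements of length `n` -/
noncomputable def D (k n : ℕ) : Finset (FreeGroup (Fin k)) :=
  ((S k n).image FreeGroup.mk).filter CyclicallyReduced

lemma mem_D {k n : ℕ} (g : FreeGroup (Fin k)) :
    g ∈ D k n ↔ CyclicallyReduced g ∧ wlen g = n := by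
  simp only [D, Finset.mem_filter, Finset.mem_image, mem_S, wlen]
  constructor
  · rintro ⟨⟨L, ⟨h1, h2⟩, rfl⟩, h⟩
    exact ⟨h, by rw [toWord_mk, h1.reduce_eq, h2]⟩
  · rintro ⟨h, h2⟩
    exact ⟨⟨g.toWord, ⟨isReduced_toWord, h2⟩, mk_toWord⟩, h⟩

lemma exists_letter {k : ℕ} (hk : 2 ≤ k) (x y : Fin k × Bool) : ∃ a, a ≠ x ∧ a ≠ y := by
  have : ({x, y} : Finset (Fin k × Bool)).card < (Finset.univ : Finset (Fin k × Bool)).card := by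
    refine lt_of_le_of_lt Finset.card_le_two ?_
    simp; omega
  obtain ⟨a, -, ha⟩ := Finset.exists_mem_notMem_of_card_lt_card this
  exact ⟨a, by simpa using ha⟩

lemma card_D_succ {k : ℕ} (hk : 2 ≤ k) (n : ℕ) : (S k n).card ≤ (D k (n+1)).card := by
  have : S k n ⊆ (D k (n+1)).image (fun g => g.toWord.tail) := by
    intro L hL
    rw [mem_S] at hL
    rw [Finset.mem_image]
    have fin : ∀ a, (∀ b, L.head? = some b → a ≠ (b.1, !b.2)) →
        (∀ b, (a :: L).getLast? = some b → a ≠ (b.1, !b.2)) →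
        ∃ g ∈ D k (n+1), g.toWord.tail = L := by
      intro a h1 h2
      have hr : IsReduced (a :: L) := (isReduced_cons_iff _ _).2 ⟨h1, hL.1⟩
      have hw : (FreeGroup.mk (a :: L)).toWord = a :: L := by rw [toWord_mk, hr.reduce_eq]
      refine ⟨FreeGroup.mk (a :: L), (mem_D _).2 ⟨?_, ?_⟩, ?_⟩
      · intro x y hx hy
        rw [hw] at hx hy
        simp only [List.head?_cons, Option.some.injEq] at hx
        subst hx
        exact h2 y hy
      · rw [wlen, hw]; simp [hL.2]
      · rw [hw]; rfl
    cases L with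
    | nil =>
      refine fin (⟨0, by omega⟩, true) (by simp) ?_
      intro b hb
      simp at hb
      subst hb
      simp
    | cons b L =>
      obtain ⟨a, ha, ha'⟩ := exists_letter hk (b.1, !b.2)
        (((b :: L).getLast (by simp)).1, !((b :: L).getLast (by simp)).2)
      refine fin a (by simpa using ha) ?_
      intro c hc
      rw [List.getLast?_cons_cons, List.getLast?_eq_some_getLast (by simp)] at hc
      simp only [Option.some.injEq] at hc
      rw [← hc]; exact ha'
  exact (Finset.card_le_card this).trans Finset.card_image_le

lemma card_D {k : ℕ} (hk : 2 ≤ k) (n : ℕ) : (2 * k - 1) ^ n ≤ (2 * k - 1) * (D k n).card := by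
  cases n with
  | zero =>
    have : (1 : FreeGroup (Fin k)) ∈ D k 0 := by
      rw [mem_D]; simp [CyclicallyReduced, wlen]
    have := Finset.card_pos.2 ⟨_, this⟩
    simp only [pow_zero]
    have h : 0 < 2 * k - 1 := by omega
    exact Nat.mul_pos h this
  | succ n =>
    rw [pow_succ, mul_comm]
    exact Nat.mul_le_mul_left _ ((le_card_S hk n).trans (card_D_succ hk n))

/-- proper powers -/
def IsPP {k : ℕ} (g : FreeGroup (Fin k)) : Prop := ∃ w : FreeGroup (Fin k), ∃ n : ℕ, 2 ≤ n ∧ g = w ^ n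

lemma conj_nil {k : ℕ} (g : FreeGroup (Fin k)) (hg : CyclicallyReduced g)
    (c v : List (Fin k × Bool)) (h : g.toWord = c ++ v ++ invRev c) : c = [] := by
  cases c with
  | nil => rfl
  | cons a c =>
    exfalso
    refine hg a (a.1, !a.2) ?_ ?_ ?_
    · rw [h]; simp
    · have : a :: c ++ v ++ invRev (a :: c) = (a :: c ++ v ++ invRev c) ++ [(a.1, !a.2)] := by
        simp [invRev]
      rw [h, this, List.getLast?_concat]
    · simp

lemma power_form {k n : ℕ} (g : FreeGroup (Fin k)) (hg : CyclicallyReduced g) (hn : wlen g = n)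
    (hp : IsPP g) : ∃ d ∈ Finset.range (n / 2 + 1), ∃ v ∈ S k d,
      (List.replicate (n / d) v).flatten = g.toWord := by
  obtain ⟨w, j, hj, rfl⟩ := hp
  have h1 := toWord_pow w j
  rw [reduceCyclically.reduce_flatten_replicate isReduced_toWord, if_neg (by omega)] at h1
  have hc := conj_nil _ hg _ _ h1
  rw [hc] at h1
  simp only [List.nil_append, invRev, List.map_nil, List.reverse_nil, List.append_nil] at h1
  have hl : n = j * (reduceCyclically w.toWord).length := by
    rw [← hn, wlen, h1]; simp
  refine ⟨(reduceCyclically w.toWord).length, ?_, reduceCyclically w.toWord, ?_, ?_⟩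
  · rw [Finset.mem_range, Nat.lt_succ_iff, Nat.le_div_iff_mul_le (by norm_num), hl, mul_comm]
    gcongr
  · rw [mem_S]
    exact ⟨(reduceCyclically.isCyclicallyReduced isReduced_toWord).isReduced, rfl⟩
  · rw [h1]
    rcases Nat.eq_zero_or_pos (reduceCyclically w.toWord).length with h0 | h0
    · rw [List.length_eq_zero_iff] at h0
      simp [h0]
    · rw [hl, Nat.mul_div_cancel _ h0]

open Classical in
lemma card_PP {k : ℕ} (hk : 2 ≤ k) (n : ℕ) :
    ((D k n).filter IsPP).card ≤ 2 * k * (2 * (2 * k - 1)) ^ (n / 2) := by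
  have hsub : ((D k n).filter IsPP).image toWord ⊆ (Finset.range (n / 2 + 1)).biUnion
      (fun d => (S k d).image (fun v => (List.replicate (n / d) v).flatten)) := by
    intro L hL
    simp only [Finset.mem_image, Finset.mem_filter, mem_D] at hL
    obtain ⟨g, ⟨⟨h1, h2⟩, h3⟩, rfl⟩ := hL
    obtain ⟨d, hd, v, hv, e⟩ := power_form g h1 h2 h3
    rw [Finset.mem_biUnion]
    exact ⟨d, hd, Finset.mem_image.2 ⟨v, hv, e⟩⟩
  have h := (Finset.card_le_card hsub).trans Finset.card_biUnion_le
  rw [Finset.card_image_of_injective _ toWord_injective] at h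
  refine h.trans ?_
  have h2 : ∀ d ∈ Finset.range (n / 2 + 1),
      ((S k d).image (fun v => (List.replicate (n / d) v).flatten)).card
        ≤ 2 * k * (2 * k - 1) ^ (n / 2) := by
    intro d hd
    refine Finset.card_image_le.trans ((card_S_le hk d).trans ?_)
    rw [Finset.mem_range] at hd
    gcongr <;> omega
  refine (Finset.sum_le_card_nsmul _ _ _ h2).trans ?_
  rw [Finset.card_range, smul_eq_mul, mul_pow]
  have : n / 2 + 1 ≤ 2 ^ (n / 2) := Nat.lt_two_pow_self
  calc _ ≤ 2 ^ (n / 2) * (2 * k * (2 * k - 1) ^ (n / 2)) := Nat.mul_le_mul_right _ this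
    _ = _ := by ring

lemma ratio_bound {k : ℕ} (hk : 2 ≤ k) (n p c : ℕ)
    (hp : p ≤ 2 * k * (2 * (2 * k - 1)) ^ (n / 2))
    (hc : (2 * k - 1) ^ n ≤ (2 * k - 1) * c) :
    (p : ℝ) / c ≤ 2 * k * (2 * k - 1) * (√(2 / (2 * k - 1))) ^ n := by
  obtain ⟨B, hB⟩ : ∃ B, B = 2 * k - 1 := ⟨_, rfl⟩
  have hBr : (2 * (k:ℝ) - 1) = B := by
    have : 2 * k = B + 1 := by omega
    have : (2 * (k:ℝ)) = B + 1 := by exact_mod_cast this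
    linarith
  rw [← hB] at hp hc
  rw [hBr]
  have hB3 : (3:ℝ) ≤ B := by
    have : 3 ≤ B := by omega
    exact_mod_cast this
  have hc' : (B:ℝ) ^ n ≤ B * c := by exact_mod_cast hc
  have hp' : (p:ℝ) ≤ 2 * k * (2 * B) ^ (n / 2) := by exact_mod_cast hp
  have hcpos : (0:ℝ) < c := by
    have : (0:ℝ) < B * c := lt_of_lt_of_le (by positivity) hc'
    exact pos_of_mul_pos_right this (by positivity)
  rw [div_le_iff₀ hcpos]
  have hq : √(2 / (B:ℝ)) * B = √(2 * B) := by
    rw [← Real.sqrt_sq (show (0:ℝ) ≤ √(2 / (B:ℝ)) * B by positivity), mul_pow,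
      Real.sq_sqrt (by positivity)]
    congr 1
    field_simp
  have h1 : (1:ℝ) ≤ √(2 * B) := by
    rw [Real.one_le_sqrt]; linarith
  calc (p:ℝ) ≤ 2 * k * (2 * B) ^ (n / 2) := hp'
    _ = 2 * k * (√(2 * B)) ^ (2 * (n / 2)) := by
        rw [pow_mul, Real.sq_sqrt (by positivity)]
    _ ≤ 2 * k * (√(2 * B)) ^ n := by
        gcongr
        omega
    _ = 2 * k * (√(2 / B)) ^ n * B ^ n := by rw [← hq, mul_pow]; ring
    _ ≤ 2 * k * (√(2 / B)) ^ n * (B * c) := by gcongr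
    _ = _ := by ring

open Classical in
lemma gamma_eq {k m : ℕ} (n : ℕ) (P : FreeGroup (Fin k) → Prop) :
    gammaA {T : Fin m → FreeGroup (Fin k) | T ∈ Cset k m ∧ ∀ i, P (T i)} n
      = ((D k n).filter P).card ^ m := by
  have : {T | T ∈ {T : Fin m → FreeGroup (Fin k) | T ∈ Cset k m ∧ ∀ i, P (T i)} ∧
      ∀ i, wlen (T i) = n} =
      ((Fintype.piFinset fun _ : Fin m => (D k n).filter P : Finset _) : Set _) := by
    ext T
    simp only [Set.mem_ofPred_eq, Cset, Finset.mem_coe, Fintype.mem_piFinset, Finset.mem_filter,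
      mem_D]
    constructor
    · rintro ⟨⟨⟨h1, h2⟩, h3⟩, h4⟩ i
      exact ⟨⟨h1 i, h4 i⟩, h3 i⟩
    · intro h
      exact ⟨⟨⟨fun i => (h i).1.1, fun i j => (h i).1.2.trans (h j).1.2.symm⟩,
        fun i => (h i).2⟩, fun i => (h i).1.2⟩
  rw [gammaA, this, Set.ncard_coe_finset, Fintype.card_piFinset_const]

end PP

open Classical in
theorem statement9 (k m : ℕ) (hk : 2 ≤ k) (hm : 1 ≤ m) :
    ExpGenericIn {T : Fin m → FreeGroup (Fin k) | T ∈ Cset k m ∧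
      ∀ i, ¬ ∃ w : FreeGroup (Fin k), ∃ n : ℕ, 2 ≤ n ∧ T i = w ^ n} := by
  have hk' : (2:ℝ) ≤ k := by exact_mod_cast hk
  have hm' : (1:ℝ) ≤ m := by exact_mod_cast hm
  have hB : (3:ℝ) ≤ 2 * k - 1 := by linarith
  have hB0 : (0:ℝ) < 2 * k - 1 := by linarith
  refine ⟨fun T hT => hT.1, m * (2 * k * (2 * k - 1)), by positivity,
    √(2 / (2 * k - 1)), by positivity, ?_, ?_⟩
  · rw [Real.sqrt_lt' one_pos, div_lt_iff₀ hB0]; linarith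
  intro n
  have e1 : gammaA {T : Fin m → FreeGroup (Fin k) | T ∈ Cset k m ∧
      ∀ i, ¬ PP.IsPP (T i)} n =
      (Finset.filter (fun g => ¬ PP.IsPP g) (PP.D k n)).card ^ m := by
    convert PP.gamma_eq (k := k) (m := m) n (fun g => ¬ PP.IsPP g)
  have e2 := PP.gamma_eq (k := k) (m := m) n (fun _ => True)
  simp only [implies_true, and_true, Set.ofPred_mem_eq, Finset.filter_true] at e2
  change |((gammaA {T : Fin m → FreeGroup (Fin k) | T ∈ Cset k m ∧
    ∀ i, ¬ PP.IsPP (T i)} n : ℝ) / (gammaA (Cset k m) n : ℝ)) - 1| ≤ _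
  rw [e1, e2]
  have hsum := Finset.card_filter_add_card_filter_not (s := PP.D k n) PP.IsPP
  have hr := PP.ratio_bound hk n _ _ (PP.card_PP hk n) (PP.card_D hk n)
  have hcpos : 0 < (PP.D k n).card := by
    have h := PP.card_D hk n
    have h2 : 0 < (2 * k - 1) ^ n := Nat.pow_pos (by omega)
    exact Nat.pos_of_mul_pos_left (lt_of_lt_of_le h2 h)
  generalize (Finset.filter (fun g => ¬ PP.IsPP g) (PP.D k n)).card = g at *
  generalize (Finset.filter PP.IsPP (PP.D k n)).card = p at *
  generalize (PP.D k n).card = c at *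
  have hc : (0:ℝ) < c := by exact_mod_cast hcpos
  have hs : (p:ℝ) + g = c := by exact_mod_cast hsum
  have hg : (g:ℝ) / c = 1 + -(p / c) := by
    field_simp; linarith
  have hle : (p:ℝ) / c ≤ 1 := by
    rw [div_le_one hc]; linarith [Nat.cast_nonneg (α := ℝ) g]
  have h0 : (0:ℝ) ≤ p / c := by positivity
  push_cast
  rw [← div_pow, hg]
  have hb := one_add_mul_le_pow (a := -((p:ℝ) / c)) (by linarith) m
  have hu : (1 + -((p:ℝ) / c)) ^ m ≤ 1 := pow_le_one₀ (by linarith) (by linarith)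
  rw [abs_of_nonpos (by linarith)]
  have := mul_le_mul_of_nonneg_left hr (by linarith : (0:ℝ) ≤ m)
  linarith
end
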